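/- arXiv:1901.02516 — 2 statements merged into one kernel-verified Lean document; each statement's English description precedes it below -/
import Mathlib

section
/- Let M be a unital C*-algebra with a tracial state τ, let D be a unital C*-subalgebra of M on which τ is faithful (d ∈ D and τ(d*d) = 0 imply d = 0), let A be a unital subalgebra of M containing D, and let Φ : A → D be a unital linear D-bimodule map (Φ(d₁ a d₂) = d₁ Φ(a) d₂ for d₁, d₂ ∈ D, a ∈ A). Then Φ satisfies the ball-Jensen inequality — i.e. Δ_τ(1 + x) ≥ 1 for every x ∈ A with Φ(x) = 0 and r(x) ≤ 1 — if and only if Φ is a τ-preserving algebra homomorphism (Φ(xy) = Φ(x)Φ(y) for all x, y ∈ A and τ(Φ(a)) = τ(a) for all a ∈ A). -/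
open scoped ComplexOrder

/-- The absolute value `|a| = (a*a)^{1/2}` in a C*-algebra. -/
noncomputable def cstarAbs {M : Type*} [CStarAlgebra M] [PartialOrder M] [StarOrderedRing M]
    (a : M) : M :=
  CFC.sqrt (star a * a)

/-- The Fuglede–Kadison determinant associated to a tracial state `τ`:
`Δ_τ(a) = inf_{ε>0} exp(τ(log(|a| + ε·1)))`. -/
noncomputable def fkDet {M : Type*} [CStarAlgebra M] [PartialOrder M] [StarOrderedRing M]
    (τ : M →ₗ[ℂ] ℂ) (a : M) : ℝ :=
  ⨅ ε : {ε : ℝ // 0 < ε}, Real.exp ((τ (CFC.log (cstarAbs a + (ε : ℝ) • 1))).re)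

section

open Filter Topology ComplexConjugate

variable {M : Type*} [CStarAlgebra M] [PartialOrder M] [StarOrderedRing M]

theorem IsStrictlyPositive.sq {u : M} (hu : IsStrictlyPositive u) : IsStrictlyPositive (u ^ 2) :=
  ⟨hu.isSelfAdjoint.sq_nonneg, hu.isUnit.pow 2⟩

theorem CStarAlgebra.hasSum_neg_log_one_sub {M : Type*} [CStarAlgebra M] [Nontrivial M]
    {k : M} (hk : IsSelfAdjoint k) (hk1 : ‖k‖ < 1) :
    HasSum (fun n : ℕ ↦ ((n + 1 : ℝ)⁻¹) • k ^ (n + 1)) (-CFC.log (1 - k)) := by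
  have hb : ∀ s ∈ spectrum ℝ k, |s| ≤ ‖k‖ := fun s hs ↦ by
    simpa using spectrum.norm_le_norm_of_mem hs
  have hlog : CFC.log (1 - k) = cfc (fun s ↦ Real.log (1 - s)) k := by
    have h1 : 1 - k = cfc (fun s : ℝ ↦ 1 - s) k := by
      rw [cfc_sub .., cfc_const_one .., cfc_id' ..]
    have hne : ∀ s ∈ spectrum ℝ k, 1 - s ≠ 0 := fun s hs ↦ by
      have := (abs_le.1 (hb s hs)).2
      linarith
    rw [CFC.log, h1, ← cfc_comp' Real.log (fun s : ℝ ↦ 1 - s) k]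
  have hsum : Summable fun n : ℕ ↦ ((n + 1 : ℝ)⁻¹) • k ^ (n + 1) := by
    refine .of_norm_bounded (summable_geometric_of_lt_one (norm_nonneg k) hk1) fun n ↦ ?_
    rw [norm_smul, Real.norm_of_nonneg (by positivity)]
    calc _ ≤ 1 * ‖k‖ ^ (n + 1) := by
          gcongr
          · exact inv_le_one_of_one_le₀ (by linarith [n.cast_nonneg (α := ℝ)])
          · exact norm_pow_le' k n.succ_pos
      _ ≤ ‖k‖ ^ n := by
          rw [one_mul, pow_succ]
          exact mul_le_of_le_one_right (by positivity) hk1.le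
  rw [hsum.hasSum_iff_tendsto_nat, tendsto_iff_norm_sub_tendsto_zero]
  refine squeeze_zero (g := fun n ↦ ‖k‖ ^ (n + 1) / (1 - ‖k‖)) (fun _ ↦ norm_nonneg _)
    (fun n ↦ ?_) ?_
  · let q : Polynomial ℝ := ∑ i ∈ Finset.range n, .C ((i + 1 : ℝ)⁻¹) * .X ^ (i + 1)
    have hq : ∑ i ∈ Finset.range n, ((i + 1 : ℝ)⁻¹) • k ^ (i + 1) = cfc q.eval k := by
      rw [cfc_polynomial q k]
      simp [q, Algebra.smul_def]
    have hc : ContinuousOn (fun s ↦ Real.log (1 - s)) (spectrum ℝ k) := by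
      refine ContinuousOn.log (by fun_prop) fun s hs ↦ ?_
      have := (abs_le.1 (hb s hs)).2
      linarith
    rw [hq, sub_neg_eq_add, hlog, ← cfc_add ..]
    refine norm_cfc_le (by have := sub_pos.2 hk1; positivity) fun s hs ↦ ?_
    have hs' := hb s hs
    have := Real.abs_log_sub_add_sum_range_le (x := s) (by linarith) n
    refine le_trans (le_of_eq ?_) (this.trans ?_)
    · simp [q, Polynomial.eval_finsetSum, div_eq_inv_mul]
    · gcongr
  · have := (tendsto_pow_atTop_nhds_zero_of_lt_one (norm_nonneg k) hk1).comp (tendsto_add_atTop_nat 1)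
    simpa using this.div_const (1 - ‖k‖)

theorem Real.log_le_cubic {s : ℝ} (hs : 0 < s) :
    Real.log s ≤ (s - 1) - 1 / 2 * (s - 1) ^ 2 + 1 / 3 * (s - 1) ^ 3 := by
  set g : ℝ → ℝ := fun u ↦ (u - 1) - 1 / 2 * (u - 1) ^ 2 + 1 / 3 * (u - 1) ^ 3 - Real.log u with hg
  have hd : ∀ u : ℝ, 0 < u → HasDerivAt g ((u - 1) ^ 3 / u) u := by
    intro u hu
    have h1 : HasDerivAt (fun u : ℝ ↦ u - 1) 1 u := (hasDerivAt_id u).sub_const 1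
    convert! ((h1.sub ((h1.pow 2).const_mul (1 / 2))).add ((h1.pow 3).const_mul (1 / 3))).sub
      (Real.hasDerivAt_log hu.ne') using 1
    field_simp
    ring
  have hg1 : g 1 = 0 := by simp [hg]
  suffices 0 ≤ g s by simpa [hg] using this
  rw [← hg1]
  rcases le_total 1 s with h | h
  · refine monotoneOn_of_hasDerivWithinAt_nonneg (convex_Icc 1 s)
      (fun u hu ↦ (hd u (by linarith [hu.1])).continuousAt.continuousWithinAt)
      (fun u hu ↦ (hd u ?_).hasDerivWithinAt) (fun u hu ↦ ?_)
      (Set.left_mem_Icc.2 h) (Set.right_mem_Icc.2 h) h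
    all_goals rw [interior_Icc] at hu
    · linarith [hu.1]
    · have := hu.1
      exact div_nonneg (pow_nonneg (by linarith) 3) (by linarith)
  · refine antitoneOn_of_hasDerivWithinAt_nonpos (convex_Icc s 1)
      (fun u hu ↦ (hd u (by linarith [hu.1])).continuousAt.continuousWithinAt)
      (fun u hu ↦ (hd u ?_).hasDerivWithinAt) (fun u hu ↦ ?_)
      (Set.left_mem_Icc.2 h) (Set.right_mem_Icc.2 h) h
    all_goals rw [interior_Icc] at hu
    · linarith [hu.1]
    · have h1 := hu.1
      have h2 := hu.2
      refine div_nonpos_of_nonpos_of_nonneg ?_ (by linarith)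
      exact Odd.pow_nonpos (by decide) (by linarith)

theorem CFC.log_le_cubic {b : M} (hb : IsStrictlyPositive b) :
    CFC.log b ≤ (b - 1) - (1 / 2 : ℝ) • (b - 1) ^ 2 + (1 / 3 : ℝ) • (b - 1) ^ 3 := by
  have hsa : IsSelfAdjoint b := hb.isSelfAdjoint
  have hpos : ∀ s ∈ spectrum ℝ b, 0 < s := fun s hs ↦ by grind
  let q : Polynomial ℝ := (.X - 1) - .C (1 / 2) * (.X - 1) ^ 2 + .C (1 / 3) * (.X - 1) ^ 3
  have hq : (b - 1) - (1 / 2 : ℝ) • (b - 1) ^ 2 + (1 / 3 : ℝ) • (b - 1) ^ 3 = cfc q.eval b := by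
    rw [cfc_polynomial q b]
    simp [q, Algebra.smul_def]
  rw [hq, CFC.log]
  refine cfc_mono (fun s hs ↦ ?_) (by fun_prop (disch := grind)) (by fun_prop)
  simpa [q] using Real.log_le_cubic (hpos s hs)

theorem PositiveLinearMap.apply_star (τ : M →ₚ[ℂ] ℂ) (a : M) : τ (star a) = conj (τ a) := by
  simpa using map_star τ a

theorem isStrictlyPositive_cstarAbs_add (a : M) {ε : ℝ} (hε : 0 < ε) :
    IsStrictlyPositive (cstarAbs a + ε • 1) := by
  refine (IsStrictlyPositive.smul hε isStrictlyPositive_one).of_le ?_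
  exact le_add_of_nonneg_left (CFC.abs_nonneg a)

theorem one_le_fkDet_iff (τ : M →ₗ[ℂ] ℂ) (a : M) :
    1 ≤ fkDet τ a ↔ ∀ ε : ℝ, 0 < ε → 0 ≤ (τ (CFC.log (cstarAbs a + ε • 1))).re := by
  have : Nonempty {ε : ℝ // 0 < ε} := ⟨⟨1, one_pos⟩⟩
  rw [fkDet, le_ciInf_iff ⟨0, by rintro _ ⟨ε, rfl⟩; exact (Real.exp_pos _).le⟩]
  simp [Real.one_le_exp_iff]

theorem PositiveLinearMap.re_cubic_nonneg (τ : M →ₚ[ℂ] ℂ) {a : M}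
    (ha : 1 ≤ fkDet τ.toLinearMap a) :
    0 ≤ (τ ((star a * a - 1) - (1 / 2 : ℝ) • (star a * a - 1) ^ 2
      + (1 / 3 : ℝ) • (star a * a - 1) ^ 3)).re := by
  rw [one_le_fkDet_iff] at ha
  let f : ℝ → M := fun ε ↦ (cstarAbs a + ε • 1) ^ 2 - 1
  let g : ℝ → ℝ := fun ε ↦ (τ (f ε - (1 / 2 : ℝ) • f ε ^ 2 + (1 / 3 : ℝ) • f ε ^ 3)).re
  have hτc : Continuous τ := map_continuous τ
  have hf : Continuous f := by fun_prop
  have hg : Continuous g := by fun_prop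
  have hf0 : f 0 = star a * a - 1 := by simp [f, show cstarAbs a ^ 2 = _ from CFC.abs_sq a]
  suffices 0 ≤ g 0 by simpa only [g, hf0] using this
  refine ge_of_tendsto (hg.continuousWithinAt (s := Set.Ioi 0) (x := 0)) ?_
  filter_upwards [self_mem_nhdsWithin] with ε hε
  have hu := isStrictlyPositive_cstarAbs_add a hε
  have h1 : CFC.log ((cstarAbs a + ε • 1) ^ 2) ≤ _ := CFC.log_le_cubic hu.sq
  rw [CFC.log_pow' 2 _ hu] at h1
  have h2 := (Complex.le_def.1 (OrderHomClass.mono τ h1)).1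
  have h3 := ha ε hε
  rw [map_nsmul] at h2
  simp only [nsmul_eq_mul, Nat.cast_ofNat, Complex.mul_re, Complex.re_ofNat, Complex.im_ofNat, zero_mul,
    sub_zero] at h2
  have h4 : 0 ≤ (τ (CFC.log (cstarAbs a + ε • 1))).re := h3
  exact le_trans (by linarith) h2

theorem norm_one_sub_inv_smul_lt_one [Nontrivial M] {h : M} (hpos : IsStrictlyPositive h) :
    ‖1 - (‖h‖ + 1)⁻¹ • h‖ < 1 := by
  have hsa : IsSelfAdjoint h := hpos.isSelfAdjoint
  have hk : 1 - (‖h‖ + 1)⁻¹ • h = cfc (fun s : ℝ ↦ 1 - (‖h‖ + 1)⁻¹ • s) h := by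
    rw [cfc_sub .., cfc_const_one .., cfc_smul .., cfc_id' ..]
  rw [hk]
  refine norm_cfc_lt one_pos fun s hs ↦ ?_
  have h0 : 0 < s := by grind
  have h1 : s ≤ ‖h‖ := (le_abs_self s).trans (by simpa using spectrum.norm_le_norm_of_mem hs)
  have h2 : s / (‖h‖ + 1) < 1 := by
    rw [div_lt_one (by positivity)]
    linarith
  have h3 : 0 < s / (‖h‖ + 1) := by positivity
  rw [Real.norm_eq_abs, abs_lt, smul_eq_mul, inv_mul_eq_div]
  constructor <;> linarith

theorem trace_hasDerivAt_pow {M : Type*} [NormedRing M] [NormedAlgebra ℂ M] (τ : M →L[ℂ] ℂ)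
    (hτ : ∀ a b, τ (a * b) = τ (b * a)) {k : ℝ → M} {k' : M} {t : ℝ} (hk : HasDerivAt k k' t)
    (n : ℕ) : HasDerivAt (fun t ↦ τ (((n + 1 : ℝ)⁻¹) • k t ^ (n + 1))) (τ (k t ^ n * k')) t := by
  have h1 := (τ.restrictScalars ℝ).hasFDerivAt.comp_hasDerivAt t
    ((hk.fun_pow' (n + 1)).const_smul ((n + 1 : ℝ)⁻¹))
  convert! h1 using 1
  have h2 : ∀ i ∈ Finset.range (n + 1), τ (k t ^ (n - i) * k' * k t ^ i) = τ (k t ^ n * k') := by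
    intro i hi
    rw [hτ, ← mul_assoc, ← pow_add, Nat.add_sub_cancel' (by simpa [Nat.lt_succ_iff] using hi)]
  rw [ContinuousLinearMap.coe_restrictScalars', τ.map_smul_of_tower, map_sum]
  simp only [Nat.pred_succ]
  rw [Finset.sum_congr rfl h2]
  have : (n + 1 : ℂ) ≠ 0 := by exact_mod_cast n.succ_ne_zero
  simp [this]

theorem trace_hasDerivAt_log [Nontrivial M] (τ : M →L[ℂ] ℂ)
    (hτ : ∀ a b, τ (a * b) = τ (b * a)) {h h' : ℝ → M}
    (hd : ∀ t, HasDerivAt h (h' t) t) (hc : Continuous h') (hsa : ∀ t, IsSelfAdjoint (h t))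
    {t₀ : ℝ} (hpos : IsStrictlyPositive (h t₀)) {b : M} (hb : b * h t₀ = 1) :
    HasDerivAt (fun t ↦ τ (CFC.log (h t))) (τ (b * h' t₀)) t₀ := by
  set c : ℝ := ‖h t₀‖ + 1 with hc_def
  have hc0 : 0 < c := by positivity
  set k : ℝ → M := fun t ↦ 1 - c⁻¹ • h t with hk_def
  set k' : ℝ → M := fun t ↦ -(c⁻¹ • h' t) with hk'_def
  have hkd : ∀ t, HasDerivAt k (k' t) t := fun t ↦ ((hd t).const_smul c⁻¹).const_sub 1
  have hkc : Continuous k := continuous_iff_continuousAt.2 fun t ↦ (hkd t).continuousAt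
  have hksa : ∀ t, IsSelfAdjoint (k t) := fun t ↦
    (IsSelfAdjoint.one M).sub ((IsSelfAdjoint.all c⁻¹).smul (hsa t))
  have hk'c : Continuous k' := by fun_prop
  obtain ⟨ρ, hρ, hρ1⟩ := exists_between (norm_one_sub_inv_smul_lt_one hpos)
  have hρ0 : 0 ≤ ρ := (norm_nonneg _).trans hρ.le
  obtain ⟨r, hr, hball⟩ := Metric.eventually_nhds_iff_ball.1
    (((hkc.norm.continuousAt (x := t₀)).eventually_lt_const (hρ : ‖k t₀‖ < ρ)).and
      ((hk'c.norm.continuousAt (x := t₀)).eventually_lt_const (lt_add_one ‖k' t₀‖)))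
  have ht₀ : t₀ ∈ Metric.ball t₀ r := Metric.mem_ball_self hr
  have hsum : ∀ t ∈ Metric.ball t₀ r, HasSum (fun n : ℕ ↦ τ (((n + 1 : ℝ)⁻¹) • k t ^ (n + 1)))
      (-τ (CFC.log (1 - k t))) := fun t ht ↦ by
    simpa using τ.hasSum
      (CStarAlgebra.hasSum_neg_log_one_sub (hksa t) ((hball t ht).1.trans hρ1))
  have hlog : ∀ t ∈ Metric.ball t₀ r, τ (CFC.log (h t)) = τ (algebraMap ℝ M (Real.log c)) -
      ∑' n : ℕ, τ (((n + 1 : ℝ)⁻¹) • k t ^ (n + 1)) := fun t ht ↦ by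
    have hu : IsUnit (1 - k t) := isUnit_one_sub_of_norm_lt_one ((hball t ht).1.trans hρ1)
    have hh : h t = c • (1 - k t) := by simp [hk_def, smul_smul, hc0.ne']
    rw [(hsum t ht).tsum_eq, sub_neg_eq_add, ← map_add, hh, CFC.log_smul (1 - k t) ?_ hc0.ne'
      ((IsSelfAdjoint.one M).sub (hksa t))]
    rintro s hs rfl
    exact spectrum.zero_notMem ℝ hu hs
  have hderiv := hasDerivAt_tsum_of_isPreconnected
    (u := fun n ↦ ‖τ‖ * (ρ ^ n * (‖k' t₀‖ + 1)))
    (((summable_geometric_of_lt_one hρ0 hρ1).mul_right _).mul_left _)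
    Metric.isOpen_ball (convex_ball t₀ r).isPreconnected
    (fun n t _ ↦ trace_hasDerivAt_pow τ hτ (hkd t) n) (fun n t ht ↦ ?_) ht₀ (hsum t₀ ht₀).summable
    ht₀
  · have hgeo := summable_geometric_of_norm_lt_one ((hball t₀ ht₀).1.trans hρ1)
    have hS : ∑' n, k t₀ ^ n = c • b := by
      have := congrArg (b * ·) hgeo.one_sub_mul_tsum_pow
      simp only [hk_def, sub_sub_cancel, smul_mul_assoc, mul_smul_comm, mul_one] at this
      rw [← mul_assoc, hb, one_mul] at this
      rw [← this, smul_smul, mul_inv_cancel₀ hc0.ne', one_smul]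
    have hval : ∑' n, τ (k t₀ ^ n * k' t₀) = -τ (b * h' t₀) := by
      rw [← τ.map_tsum (hgeo.mul_right _), hgeo.tsum_mul_right, hS]
      simp [hk'_def, smul_smul, hc0.ne']
    rw [hval] at hderiv
    have := hderiv.const_sub (τ (algebraMap ℝ M (Real.log c)))
    rw [neg_neg] at this
    exact this.congr_of_eventuallyEq
      (Filter.eventually_of_mem (Metric.ball_mem_nhds t₀ hr) hlog)
  · obtain ⟨h1, h2⟩ := hball t ht
    refine (τ.le_opNorm _).trans ?_
    gcongr
    refine (norm_mul_le _ _).trans ?_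
    gcongr
    exact (norm_pow_le _ _).trans (by gcongr)

theorem summable_smul_pow_of_spectralRadius_le_one {M : Type*} [NormedRing M] [NormedAlgebra ℂ M]
    [CompleteSpace M] {x : M} (hx : spectralRadius ℂ x ≤ 1) {z : ℂ} (hz : ‖z‖ < 1) :
    Summable fun n : ℕ ↦ (z • x) ^ n := by
  obtain ⟨ρ, hρ, hρ1⟩ := exists_between hz
  have hρ0 : 0 < ρ := (norm_nonneg z).trans_lt hρ
  have hev : ∀ᶠ n : ℕ in atTop, ‖(z • x) ^ n‖ ≤ (‖z‖ * ρ⁻¹) ^ n := by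
    have h1 : (1 : ENNReal) < ENNReal.ofReal ρ⁻¹ := by
      rw [← ENNReal.ofReal_one]
      exact (ENNReal.ofReal_lt_ofReal_iff (by positivity)).2 ((one_lt_inv₀ hρ0).2 hρ1)
    filter_upwards [(spectrum.pow_norm_pow_one_div_tendsto_nhds_spectralRadius x).eventually_lt_const
      (hx.trans_lt h1), eventually_ne_atTop 0] with n hn hn0
    have h2 := (ENNReal.ofReal_lt_ofReal_iff (by positivity)).1 hn
    rw [smul_pow, norm_smul, norm_pow, mul_pow]
    gcongr
    calc ‖x ^ n‖ = (‖x ^ n‖ ^ (1 / n : ℝ)) ^ n := by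
          rw [one_div, Real.rpow_inv_natCast_pow (norm_nonneg _) hn0]
      _ ≤ ρ⁻¹ ^ n := by gcongr
  refine Summable.of_norm_bounded_eventually_nat (summable_geometric_of_lt_one (by positivity) ?_) hev
  rwa [← div_eq_mul_inv, div_lt_one hρ0]

theorem isStrictlyPositive_star_mul_self {a : M} (ha : IsUnit a) :
    IsStrictlyPositive (star a * a) :=
  ⟨star_mul_self_nonneg a, ha.star.mul ha⟩

theorem one_le_fkDet_of_trace_log_eq_zero (τ : M →ₚ[ℂ] ℂ) {a : M} (ha : IsUnit a)
    (h : τ (CFC.log (star a * a)) = 0) : 1 ≤ fkDet τ.toLinearMap a := by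
  have hsq : cstarAbs a ^ 2 = star a * a := CFC.abs_sq a
  have hpos : IsStrictlyPositive (cstarAbs a) := by
    refine ⟨CFC.abs_nonneg a, (isUnit_pow_iff two_ne_zero).1 ?_⟩
    rw [hsq]
    exact ha.star.mul ha
  rw [one_le_fkDet_iff]
  intro ε hε
  have h1 : τ (CFC.log (cstarAbs a)) = 0 := by
    rw [← hsq, CFC.log_pow' 2 _ hpos, map_nsmul] at h
    simpa using h
  have h2 : CFC.log (cstarAbs a) ≤ CFC.log (cstarAbs a + ε • 1) :=
    CFC.log_le_log (le_add_of_nonneg_right (smul_nonneg hε.le zero_le_one)) hpos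
  have h3 := (Complex.le_def.1 (OrderHomClass.mono τ h2)).1
  rw [h1] at h3
  exact h3

theorem trace_log_eq_zero_of_trace_pow_eq_zero [Nontrivial M] (τ : M →ₚ[ℂ] ℂ)
    (hτ : ∀ a b, τ (a * b) = τ (b * a)) {x : M} (hx : ∀ n : ℕ, τ (x ^ (n + 1)) = 0)
    (hr : spectralRadius ℂ x ≤ 1) {t : ℝ} (ht0 : 0 ≤ t) (ht1 : t < 1) :
    IsUnit (1 + t • x) ∧ τ (CFC.log (star (1 + t • x) * (1 + t • x))) = 0 := by
  let σ : M →L[ℂ] ℂ := ⟨τ.toLinearMap, map_continuous τ⟩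
  have hσ : ∀ a, σ a = τ a := fun _ ↦ rfl
  let a : ℝ → M := fun t ↦ 1 + t • x
  let h : ℝ → M := fun t ↦ star (a t) * a t
  let h' : ℝ → M := fun t ↦ star x * a t + star (a t) * x
  have had : ∀ t, HasDerivAt a x t := fun t ↦ by
    have := ((hasDerivAt_id t).smul_const x).const_add 1
    rwa [one_smul] at this
  have hhd : ∀ t, HasDerivAt h (h' t) t := fun t ↦ (had t).star.mul (had t)
  have hac : Continuous a := by fun_prop
  have hh'c : Continuous h' := by fun_prop
  have hinv : ∀ s ∈ Set.Ico (0 : ℝ) 1, ∃ b, a s * b = 1 ∧ b * a s = 1 ∧ τ (x * b) = 0 := by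
    intro s hs
    have hsum : Summable fun n : ℕ ↦ ((-s : ℂ) • x) ^ n :=
      summable_smul_pow_of_spectralRadius_le_one hr (by simpa [abs_of_nonneg hs.1] using hs.2)
    have has : a s = 1 - (-s : ℂ) • x := by simp [a]
    refine ⟨∑' n : ℕ, ((-s : ℂ) • x) ^ n, ?_, ?_, ?_⟩
    · rw [has, hsum.one_sub_mul_tsum_pow]
    · rw [has, hsum.tsum_pow_mul_one_sub]
    · rw [← hsum.tsum_mul_left, ← hσ, σ.map_tsum (hsum.mul_left _)]
      refine (tsum_congr fun n ↦ ?_).trans tsum_zero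
      rw [smul_pow, mul_smul_comm, ← pow_succ', hσ, map_smul, hx, smul_zero]
  have hunit : ∀ s ∈ Set.Ico (0 : ℝ) 1, IsUnit (a s) := fun s hs ↦ by
    obtain ⟨b, h1, h2, -⟩ := hinv s hs
    exact ⟨⟨a s, b, h1, h2⟩, rfl⟩
  have hderiv : ∀ s ∈ Set.Ico (0 : ℝ) 1, HasDerivAt (fun t ↦ σ (CFC.log (h t))) 0 s := by
    intro s hs
    obtain ⟨b, h1, h2, h3⟩ := hinv s hs
    have hb : b * star b * h s = 1 := by
      calc b * star b * (star (a s) * a s) = b * star (a s * b) * a s := by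
            simp only [star_mul, mul_assoc]
        _ = 1 := by simp [h1, h2]
    convert! trace_hasDerivAt_log σ hτ hhd hh'c (fun t ↦ IsSelfAdjoint.star_mul_self (a t))
      (isStrictlyPositive_star_mul_self (hunit s hs)) hb using 1
    have e1 : τ (b * star b * (star x * a s)) = 0 := by
      rw [show b * star b * (star x * a s) = b * (star (x * b) * a s) by
        simp only [star_mul, mul_assoc], hτ, mul_assoc, h1, mul_one, τ.apply_star, h3, map_zero]
    have e2 : τ (b * star b * (star (a s) * x)) = 0 := by
      rw [show b * star b * (star (a s) * x) = b * (star (a s * b) * x) by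
        simp only [star_mul, mul_assoc], h1, star_one, one_mul, hτ, h3]
    rw [hσ, mul_add, map_add, e1, e2, add_zero]
  refine ⟨hunit t ⟨ht0, ht1⟩, ?_⟩
  have hconst := constant_of_has_deriv_right_zero (a := 0) (b := t)
    (fun s hs ↦ (hderiv s ⟨hs.1, hs.2.trans_lt ht1⟩).continuousAt.continuousWithinAt)
    (fun s hs ↦ (hderiv s ⟨hs.1, hs.2.trans ht1⟩).hasDerivWithinAt) t (Set.right_mem_Icc.2 ht0)
  have h0 : σ (CFC.log (h 0)) = 0 := by simp [h, a]
  exact hconst.trans h0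

theorem one_le_fkDet_of_trace_pow_eq_zero [Nontrivial M] (τ : M →ₚ[ℂ] ℂ)
    (hτ : ∀ a b, τ (a * b) = τ (b * a)) {x : M} (hx : ∀ n : ℕ, τ (x ^ (n + 1)) = 0)
    (hr : spectralRadius ℂ x ≤ 1) : 1 ≤ fkDet τ.toLinearMap (1 + x) := by
  rw [one_le_fkDet_iff]
  intro ε hε
  have habs : Continuous (cstarAbs : M → M) := CFC.continuous_abs
  have hlog : Continuous fun a : M ↦ CFC.log (cstarAbs a + ε • 1) :=
    CFC.continuousOn_log.comp_continuous (by fun_prop) fun a ↦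
      ⟨(isStrictlyPositive_cstarAbs_add a hε).isSelfAdjoint,
        (isStrictlyPositive_cstarAbs_add a hε).isUnit⟩
  have hcont : Continuous fun t : ℝ ↦ (τ (CFC.log (cstarAbs (1 + t • x) + ε • 1))).re :=
    Complex.continuous_re.comp ((map_continuous τ).comp (hlog.comp (by fun_prop)))
  have hlim := hcont.continuousWithinAt (s := Set.Iio 1) (x := 1)
  have := ge_of_tendsto (b := 0) hlim ?_
  · simpa using this
  filter_upwards [Ioo_mem_nhdsLT (zero_lt_one (α := ℝ))] with t ht
  obtain ⟨h1, h2⟩ := trace_log_eq_zero_of_trace_pow_eq_zero τ hτ hx hr ht.1.le ht.2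
  exact (one_le_fkDet_iff _ _).1 (one_le_fkDet_of_trace_log_eq_zero τ h1 h2) ε hε

theorem eventually_re_trace_nonneg (τ : M →ₚ[ℂ] ℂ) {u : M}
    (hu : ∀ᶠ t : ℝ in 𝓝[>] 0, 1 ≤ fkDet τ.toLinearMap (1 + t • u)) :
    ∀ᶠ t : ℝ in 𝓝[>] 0, 0 ≤ (τ (u + star u + t • (star u * u))).re
      - t / 2 * (τ ((u + star u + t • (star u * u)) ^ 2)).re
      + t ^ 2 / 3 * (τ ((u + star u + t • (star u * u)) ^ 3)).re := by
  filter_upwards [hu, self_mem_nhdsWithin] with t ht ht0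
  have h1 := τ.re_cubic_nonneg ht
  set v := u + star u + t • (star u * u) with hv
  have h2 : star (1 + t • u) * (1 + t • u) - 1 = t • v := by
    simp only [hv, star_add, star_one, star_smul, star_trivial, add_mul, mul_add, one_mul, mul_one,
      smul_mul_assoc, mul_smul_comm, smul_add]
    abel
  rw [h2, smul_pow, smul_pow, map_add, map_sub] at h1
  simp only [τ.map_smul_of_tower, Complex.add_re, Complex.sub_re, Complex.real_smul,
    Complex.re_ofReal_mul] at h1
  refine nonneg_of_mul_nonneg_right (a := t) ?_ ht0
  linarith

theorem re_trace_nonneg_of_one_le_fkDet (τ : M →ₚ[ℂ] ℂ) {u : M}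
    (hu : ∀ᶠ t : ℝ in 𝓝[>] 0, 1 ≤ fkDet τ.toLinearMap (1 + t • u)) : 0 ≤ (τ u).re := by
  have hτc : Continuous τ := map_continuous τ
  have hc : Continuous fun t : ℝ ↦ (τ (u + star u + t • (star u * u))).re
      - t / 2 * (τ ((u + star u + t • (star u * u)) ^ 2)).re
      + t ^ 2 / 3 * (τ ((u + star u + t • (star u * u)) ^ 3)).re := by fun_prop
  have h := ge_of_tendsto (hc.continuousWithinAt (s := Set.Ioi 0) (x := 0))
    (eventually_re_trace_nonneg τ hu)
  have h2 : 0 ≤ (τ u).re + (τ u).re := by simpa [τ.apply_star] using h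
  linarith

theorem re_trace_sq_nonpos_of_one_le_fkDet (τ : M →ₚ[ℂ] ℂ) (hτ : ∀ a b, τ (a * b) = τ (b * a))
    {u : M} (hu : ∀ᶠ t : ℝ in 𝓝[>] 0, 1 ≤ fkDet τ.toLinearMap (1 + t • u)) (hu0 : τ u = 0) :
    (τ (u * u)).re ≤ 0 := by
  have hτc : Continuous τ := map_continuous τ
  have hc : Continuous fun t : ℝ ↦ (τ (star u * u)).re
      - 1 / 2 * (τ ((u + star u + t • (star u * u)) ^ 2)).re
      + t / 3 * (τ ((u + star u + t • (star u * u)) ^ 3)).re := by fun_prop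
  have h := ge_of_tendsto (b := 0) (hc.continuousWithinAt (s := Set.Ioi 0) (x := 0)) ?_
  · have hsq : (u + star u) ^ 2 = u * u + u * star u + (star u * u + star (u * u)) := by
      rw [star_mul]
      noncomm_ring
    simp only [zero_smul, add_zero, zero_div, zero_mul, hsq, map_add, Complex.add_re, τ.apply_star,
      Complex.conj_re, hτ u (star u)] at h
    linarith
  · filter_upwards [eventually_re_trace_nonneg τ hu, self_mem_nhdsWithin] with t ht ht0
    have h1 : (τ (u + star u + t • (star u * u))).re = t * (τ (star u * u)).re := by
      simp [τ.apply_star, hu0]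
    rw [h1] at ht
    refine nonneg_of_mul_nonneg_right (a := t) ?_ ht0
    linarith

theorem trace_eq_zero_of_one_le_fkDet (τ : M →ₚ[ℂ] ℂ) (hτ : ∀ a b, τ (a * b) = τ (b * a)) {x : M}
    (hx : ∀ z : ℂ, ‖z • x‖ ≤ 1 → 1 ≤ fkDet τ.toLinearMap (1 + z • x)) :
    τ x = 0 ∧ τ (x * x) = 0 := by
  have hev : ∀ w : ℂ, ∀ᶠ t : ℝ in 𝓝[>] 0, 1 ≤ fkDet τ.toLinearMap (1 + t • (w • x)) := by
    intro w
    have hc : Continuous fun t : ℝ ↦ ‖t • (w • x)‖ := by fun_prop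
    have h0 : ∀ᶠ t : ℝ in 𝓝 0, ‖t • (w • x)‖ < 1 :=
      hc.continuousAt.eventually_lt_const (by simp)
    filter_upwards [nhdsWithin_le_nhds h0] with t ht
    rw [← smul_assoc] at ht ⊢
    exact hx _ ht.le
  have h1 : τ x = 0 := by
    have := re_trace_nonneg_of_one_le_fkDet τ (hev (-star (τ x)))
    rw [map_smul, smul_eq_mul, neg_mul, Complex.star_def, Complex.conj_mul', ← Complex.ofReal_pow,
      Complex.neg_re, Complex.ofReal_re, neg_nonneg] at this
    exact norm_eq_zero.1 (pow_eq_zero_iff two_ne_zero |>.1 (le_antisymm this (sq_nonneg _)))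
  refine ⟨h1, ?_⟩
  obtain ⟨w, hw⟩ := IsAlgClosed.exists_pow_nat_eq (star (τ (x * x))) two_pos
  have := re_trace_sq_nonpos_of_one_le_fkDet τ hτ (hev w) (by simp [h1])
  rw [smul_mul_smul_comm, ← pow_two, hw, map_smul, smul_eq_mul, Complex.star_def,
    Complex.conj_mul', ← Complex.ofReal_pow, Complex.ofReal_re] at this
  exact norm_eq_zero.1 (pow_eq_zero_iff two_ne_zero |>.1 (le_antisymm this (sq_nonneg _)))

end

/-- **noncommutative Bishop–Ito–Schreiber.** Let `M` be a unital C*-algebra with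
a tracial state `τ`, `D` a unital C*-subalgebra of `M` on which `τ` is faithful, `A` a unital
subalgebra of `M` containing `D`, and `Φ : A → D` a unital linear `D`-bimodule map. Then `Φ`
satisfies the ball-Jensen inequality (`Δ_τ(1 + x) ≥ 1` whenever `x ∈ A`, `Φ(x) = 0`, `r(x) ≤ 1`)
if and only if `Φ` is a `τ`-preserving algebra homomorphism. -/
theorem ball_jensen_iff_trace_preserving_hom
    {M : Type*} [CStarAlgebra M] [PartialOrder M] [StarOrderedRing M]
    (τ : M →ₗ[ℂ] ℂ)
    (hτ1 : τ 1 = 1)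
    (hτpos : ∀ a : M, 0 ≤ a → 0 ≤ τ a)
    (hτtr : ∀ a b : M, τ (a * b) = τ (b * a))
    (D A : Subalgebra ℂ M)
    (hDstar : ∀ d ∈ D, star d ∈ D)
    (hDclosed : IsClosed (D : Set M))
    (hτfaithfulD : ∀ d ∈ D, τ (star d * d) = 0 → d = 0)
    (hDA : D ≤ A)
    (Φ : ↥A →ₗ[ℂ] M)
    (hΦD : ∀ a : ↥A, Φ a ∈ D)
    (hΦ1 : Φ 1 = 1)
    (hΦbimod : ∀ d₁ : M, ∀ hd₁ : d₁ ∈ D, ∀ d₂ : M, ∀ hd₂ : d₂ ∈ D, ∀ a : ↥A,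
      Φ ⟨d₁ * (a : M) * d₂, mul_mem (mul_mem (hDA hd₁) a.2) (hDA hd₂)⟩ = d₁ * Φ a * d₂) :
    (∀ x : ↥A, Φ x = 0 → spectralRadius ℂ (x : M) ≤ 1 → 1 ≤ fkDet τ (1 + (x : M))) ↔
      ((∀ x y : ↥A, Φ (x * y) = Φ x * Φ y) ∧ ∀ a : ↥A, τ (Φ a) = τ (a : M)) := by
  have : Nontrivial M := ⟨1, 0, fun h ↦ by simp [h] at hτ1⟩
  obtain ⟨τ, rfl⟩ : ∃ σ : M →ₚ[ℂ] ℂ, σ.toLinearMap = τ := ⟨.mk₀ τ hτpos, rfl⟩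
  have hmul : ∀ d (hd : d ∈ D) (a : A), Φ (a * ⟨d, hDA hd⟩) = Φ a * d := fun d hd a ↦ by
    simpa using! hΦbimod 1 D.one_mem d hd a
  have hΦid : ∀ d (hd : d ∈ D), Φ ⟨d, hDA hd⟩ = d := fun d hd ↦ by
    simpa [hΦ1] using hmul d hd 1
  have hker : ∀ a : A, Φ (a - ⟨Φ a, hDA (hΦD a)⟩) = 0 := fun a ↦ by
    rw [map_sub, sub_eq_zero]
    exact (hΦid _ (hΦD a)).symm
  constructor
  · intro hJ
    have hzero : ∀ x : A, Φ x = 0 → τ (x : M) = 0 ∧ τ (x * x : M) = 0 := fun x hx ↦ by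
      refine trace_eq_zero_of_one_le_fkDet τ hτtr fun z hz ↦ hJ (z • x) (by simp [hx]) ?_
      refine (spectrum.spectralRadius_le_nnnorm _).trans ?_
      exact_mod_cast hz
    have hpres : ∀ a : A, τ (Φ a) = τ (a : M) := fun a ↦ by
      have := (hzero _ (hker a)).1
      rw [AddSubgroupClass.coe_sub, map_sub, sub_eq_zero] at this
      exact this.symm
    have hprod : ∀ x y : A, Φ x = 0 → Φ y = 0 → τ (x * y : M) = 0 := fun x y hx hy ↦ by
      have h1 := (hzero (x + y) (by simp [hx, hy])).2
      have h2 : ((x + y : A) * (x + y : A) : M) = x * x + x * y + (y * x + y * y) := by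
        push_cast
        noncomm_ring
      have h3 : τ (y * x : M) = τ (x * y : M) := hτtr _ _
      rw [h2, map_add, map_add, map_add, (hzero x hx).2, (hzero y hy).2, h3, zero_add, add_zero,
        ← two_mul] at h1
      simpa using h1
    have hideal : ∀ x y : A, Φ x = 0 → Φ y = 0 → Φ (x * y) = 0 := fun x y hx hy ↦ by
      have hd := hDstar _ (hΦD (x * y))
      refine hτfaithfulD _ (hΦD _) ?_
      have h1 := hprod x (y * ⟨_, hDA hd⟩) hx (by rw [hmul _ hd, hy, zero_mul])
      rw [hτtr, ← hmul _ hd]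
      refine (hpres _).trans ?_
      simpa [mul_assoc] using h1
    refine ⟨fun x y ↦ ?_, hpres⟩
    have h1 := hideal _ _ (hker x) (hker y)
    have h2 : Φ (⟨Φ x, hDA (hΦD x)⟩ * (y - ⟨Φ y, hDA (hΦD y)⟩)) = 0 := by
      have := hΦbimod (Φ x) (hΦD x) 1 D.one_mem (y - ⟨Φ y, hDA (hΦD y)⟩)
      rw [hker, mul_zero, zero_mul] at this
      rw [← this]
      congr 1
      ext
      simp
    rw [sub_mul, map_sub, h2, sub_zero, mul_sub, map_sub, hmul _ (hΦD y), sub_eq_zero] at h1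
    exact h1
  · rintro ⟨hhom, hpres⟩ x hx hr
    have hpow : ∀ n : ℕ, τ ((x : M) ^ (n + 1)) = 0 := fun n ↦ by
      have h1 := hpres (x ^ (n + 1))
      rw [pow_succ, hhom, hx, mul_zero, map_zero] at h1
      simpa [pow_succ] using h1.symm
    exact one_le_fkDet_of_trace_pow_eq_zero τ hτtr hpow hr
end

section
/- Let B be a unital C*-algebra, A a norm-closed unital subalgebra of B, and D a C*-subalgebra of A containing the unit of B. Let Φ, Ψ : A → D be D-characters, i.e. unital contractive algebra homomorphisms restricting to the identity on D. Then the following are equivalent: (1) ‖Φ − Ψ‖ < 2, i.e. sup{‖Φ(a) − Ψ(a)‖ : a ∈ A, ‖a‖ ≤ 1} < 2; (2) the restriction of Φ to ker Ψ has norm < 1, i.e. there is c < 1 with ‖Φ(x)‖ ≤ c‖x‖ for all x ∈ A with Ψ(x) = 0; (3) there is a constant M > 0 with ρ(Φ(a), Ψ(a)) ≤ M for all a ∈ A with ‖a‖ < 1; (4) for every sequence (aₙ) in the closed unit ball of A, if ‖Φ(aₙ)‖ → 1 then ‖Ψ(aₙ)‖ → 1. -/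
/-- The inverse hyperbolic tangent `artanh t = (1/2)·log((1+t)/(1-t))`. -/
noncomputable def artanh (t : ℝ) : ℝ := Real.log ((1 + t) / (1 - t)) / 2

/-- `(1 - x x*)^{-1/2}`-type inverse square roots via the continuous functional calculus. -/
noncomputable def cfcInvSqrt {B : Type*} [CStarAlgebra B] (a : B) : B :=
  cfc (fun t : ℝ => (Real.sqrt t)⁻¹) a

/-- Square roots via the continuous functional calculus. -/
noncomputable def cfcSqrt {B : Type*} [CStarAlgebra B] (a : B) : B :=
  cfc Real.sqrt a

/-- The Möbius map `T_x(y) = (1 − x x*)^{-1/2} (x + y)(1 + x* y)^{-1} (1 − x* x)^{1/2}`. -/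
noncomputable def mobiusMap {B : Type*} [CStarAlgebra B] (x y : B) : B :=
  cfcInvSqrt (1 - x * star x) * (x + y) * Ring.inverse (1 + star x * y) *
    cfcSqrt (1 - star x * x)

/-- The hyperbolic distance
`ρ(x,y) = artanh ‖(1 − x x*)^{-1/2} (x − y)(1 − x* y)^{-1} (1 − x* x)^{1/2}‖ = artanh ‖T_{−x}(y)‖`
on the open unit ball of a unital C*-algebra. -/
noncomputable def hypDist {B : Type*} [CStarAlgebra B] (x y : B) : ℝ :=
  artanh ‖cfcInvSqrt (1 - x * star x) * (x - y) * Ring.inverse (1 - star x * y) *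
    cfcSqrt (1 - star x * x)‖

open Filter


section InvSqrt

variable {B : Type*} [CStarAlgebra B]

lemma isSelfAdjoint_cfcInvSqrt (e : B) : IsSelfAdjoint (cfcInvSqrt e) :=
  cfc_predicate (R := ℝ) _ e

lemma isSelfAdjoint_cfcSqrt (e : B) : IsSelfAdjoint (cfcSqrt e) :=
  cfc_predicate (R := ℝ) _ e

lemma continuousOn_inv_sqrt {s : Set ℝ} (hs : ∀ t ∈ s, 0 < t) :
    ContinuousOn (fun t : ℝ => (Real.sqrt t)⁻¹) s :=
  Real.continuous_sqrt.continuousOn.inv₀ fun t ht => (Real.sqrt_pos.2 (hs t ht)).ne'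

lemma cfcSqrt_mul_self {e : B} (he : IsSelfAdjoint e) (hpos : ∀ t ∈ spectrum ℝ e, 0 < t) :
    cfcSqrt e * cfcSqrt e = e := by
  rw [cfcSqrt, ← cfc_mul _ _ e]
  conv_rhs => rw [← cfc_id' ℝ e]
  exact cfc_congr fun t ht => Real.mul_self_sqrt (hpos t ht).le

lemma cfcInvSqrt_mul_cfcSqrt {e : B} (he : IsSelfAdjoint e) (hpos : ∀ t ∈ spectrum ℝ e, 0 < t) :
    cfcInvSqrt e * cfcSqrt e = 1 := by
  rw [cfcSqrt, cfcInvSqrt, ← cfc_mul _ _ e (continuousOn_inv_sqrt hpos), ← cfc_const_one ℝ e]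
  exact cfc_congr fun t ht => inv_mul_cancel₀ (Real.sqrt_pos.2 (hpos t ht)).ne'

lemma cfcSqrt_mul_cfcInvSqrt {e : B} (he : IsSelfAdjoint e) (hpos : ∀ t ∈ spectrum ℝ e, 0 < t) :
    cfcSqrt e * cfcInvSqrt e = 1 := by
  rw [cfcSqrt, cfcInvSqrt, ← cfc_mul _ _ e (hg := continuousOn_inv_sqrt hpos), ← cfc_const_one ℝ e]
  exact cfc_congr fun t ht => mul_inv_cancel₀ (Real.sqrt_pos.2 (hpos t ht)).ne'

lemma cfcInvSqrt_sq_mul {e : B} (he : IsSelfAdjoint e) (hpos : ∀ t ∈ spectrum ℝ e, 0 < t) :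
    cfcInvSqrt e * cfcInvSqrt e * e = 1 := by
  nth_rw 3 [← cfcSqrt_mul_self he hpos]
  rw [mul_assoc, ← mul_assoc (cfcInvSqrt e) (cfcSqrt e), cfcInvSqrt_mul_cfcSqrt he hpos, one_mul,
    cfcInvSqrt_mul_cfcSqrt he hpos]

lemma mul_cfcInvSqrt_sq {e : B} (he : IsSelfAdjoint e) (hpos : ∀ t ∈ spectrum ℝ e, 0 < t) :
    e * (cfcInvSqrt e * cfcInvSqrt e) = 1 := by
  nth_rw 1 [← cfcSqrt_mul_self he hpos]
  rw [mul_assoc, ← mul_assoc (cfcSqrt e) (cfcInvSqrt e), cfcSqrt_mul_cfcInvSqrt he hpos, one_mul,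
    cfcSqrt_mul_cfcInvSqrt he hpos]

lemma spectrum_one_sub_pos {p : B} (hp : ‖p‖ < 1) : ∀ t ∈ spectrum ℝ (1 - p), 0 < t := by
  intro t ht
  rcases subsingleton_or_nontrivial B with _ | _
  · simp [spectrum.of_subsingleton] at ht
  have h1 : 1 - t ∈ spectrum ℝ p := by
    rw [spectrum.mem_iff] at ht ⊢
    rwa [← IsUnit.neg_iff, show -(algebraMap ℝ B (1 - t) - p) = algebraMap ℝ B t - (1 - p) by
      rw [map_sub, map_one]; abel]
  have := spectrum.norm_le_norm_of_mem h1
  rw [Real.norm_eq_abs] at this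
  linarith [le_abs_self (1 - t)]

end InvSqrt

section Moebius

variable {B : Type*} [CStarAlgebra B]

/-- The element whose norm is the pseudo-hyperbolic distance between `d` and `a`. -/
noncomputable def pseudoHypDiff (d a : B) : B :=
  cfcInvSqrt (1 - d * star d) * (d - a) * Ring.inverse (1 - star d * a) *
    cfcSqrt (1 - star d * d)

lemma hypDist_eq_artanh (x y : B) : hypDist x y = artanh ‖pseudoHypDiff x y‖ := rfl

lemma norm_star_mul_lt_one {d a : B} (hd : ‖d‖ < 1) (ha : ‖a‖ ≤ 1) : ‖star d * a‖ < 1 :=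
  calc ‖star d * a‖ ≤ ‖star d‖ * ‖a‖ := norm_mul_le _ _
    _ = ‖d‖ * ‖a‖ := by rw [norm_star]
    _ ≤ ‖d‖ := mul_le_of_le_one_right (norm_nonneg _) ha
    _ < 1 := hd

lemma isSelfAdjoint_one_sub_star_mul (d : B) : IsSelfAdjoint (1 - star d * d) :=
  (IsSelfAdjoint.one B).sub (.star_mul_self d)

lemma isSelfAdjoint_one_sub_mul_star (d : B) : IsSelfAdjoint (1 - d * star d) :=
  (IsSelfAdjoint.one B).sub (.mul_star_self d)

lemma spectrum_one_sub_star_mul_pos {d : B} (hd : ‖d‖ < 1) :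
    ∀ t ∈ spectrum ℝ (1 - star d * d), 0 < t :=
  spectrum_one_sub_pos (norm_star_mul_lt_one hd hd.le)

lemma spectrum_one_sub_mul_star_pos {d : B} (hd : ‖d‖ < 1) :
    ∀ t ∈ spectrum ℝ (1 - d * star d), 0 < t := by
  refine spectrum_one_sub_pos ?_
  rw [CStarRing.norm_self_mul_star, ← CStarRing.norm_star_mul_self]
  exact norm_star_mul_lt_one hd hd.le

/-- The algebraic identity behind the contractivity of Möbius maps. -/
lemma moebius_identity {R : Type*} [Ring R] {d d' a a' E F : R}
    (hE₁ : E * (1 - d' * d) = 1) (hE₂ : (1 - d' * d) * E = 1)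
    (hF₁ : F * (1 - d * d') = 1) (hF₂ : (1 - d * d') * F = 1) :
    (1 - a' * d) * E * (1 - d' * a) - (d' - a') * F * (d - a) = 1 - a' * a := by
  have h₁ : E * d' = d' * F := by
    calc E * d' = E * d' * ((1 - d * d') * F) := by rw [hF₂, mul_one]
      _ = E * (1 - d' * d) * (d' * F) := by noncomm_ring
      _ = d' * F := by rw [hE₁, one_mul]
  have h₂ : d * E = F * d := by
    calc d * E = F * (1 - d * d') * (d * E) := by rw [hF₁, one_mul]
      _ = F * d * ((1 - d' * d) * E) := by noncomm_ring
      _ = F * d := by rw [hE₂, mul_one]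
  have h₃ : d' * F * d = E - 1 := by
    rw [← h₁, ← hE₁]; noncomm_ring
  have h₄ : d * E * d' = F - 1 := by
    rw [h₂, ← hF₁]; noncomm_ring
  calc (1 - a' * d) * E * (1 - d' * a) - (d' - a') * F * (d - a)
      = E - E * d' * a - a' * (d * E) + a' * (d * E * d') * a
        - (d' * F * d - d' * F * a - a' * (F * d) + a' * F * a) := by noncomm_ring
    _ = 1 - a' * a := by rw [h₃, h₄, h₁, h₂]; noncomm_ring

/-- `1 - T* T` factors through `1 - a* a`, where `T` is the image of `a` under the Möbius map
attached to `d`, by an element whose inverse has norm at most `1 / (1 - ‖d‖)`. -/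
lemma exists_one_sub_star_mul_pseudoHypDiff {d a : B} (hd : ‖d‖ < 1) (ha : ‖a‖ ≤ 1) :
    ∃ W Z : B, W * Z = 1 ∧ Z * W = 1 ∧ ‖Z‖ * (1 - ‖d‖) ≤ 1 ∧
      Z = Ring.inverse (1 - star d * a) * cfcSqrt (1 - star d * d) ∧
      1 - star (pseudoHypDiff d a) * pseudoHypDiff d a = star Z * (1 - star a * a) * Z := by
  have he := isSelfAdjoint_one_sub_star_mul d
  have hf := isSelfAdjoint_one_sub_mul_star d
  have hepos := spectrum_one_sub_star_mul_pos hd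
  have hfpos := spectrum_one_sub_mul_star_pos hd
  have hunit : IsUnit (1 - star d * a) :=
    isUnit_one_sub_of_norm_lt_one (norm_star_mul_lt_one hd ha)
  have hVl := Ring.inverse_mul_cancel _ hunit
  have hVr := Ring.mul_inverse_cancel _ hunit
  have hRQ := cfcInvSqrt_mul_cfcSqrt he hepos
  have hQR := cfcSqrt_mul_cfcInvSqrt he hepos
  have hQQ := cfcSqrt_mul_self he hepos
  have hid := moebius_identity (a := a) (a' := star a)
    (cfcInvSqrt_sq_mul he hepos) (mul_cfcInvSqrt_sq he hepos)
    (cfcInvSqrt_sq_mul hf hfpos) (mul_cfcInvSqrt_sq hf hfpos)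
  have hP := isSelfAdjoint_cfcInvSqrt (1 - d * star d)
  have hR := isSelfAdjoint_cfcInvSqrt (1 - star d * d)
  have hQ := isSelfAdjoint_cfcSqrt (1 - star d * d)
  unfold pseudoHypDiff
  set P := cfcInvSqrt (1 - d * star d)
  set R := cfcInvSqrt (1 - star d * d)
  set Q := cfcSqrt (1 - star d * d)
  set V := Ring.inverse (1 - star d * a)
  have hWZ : (R * (1 - star d * a)) * (V * Q) = 1 := by
    rw [mul_assoc, ← mul_assoc _ V, hVr, one_mul, hRQ]
  have hZW : (V * Q) * (R * (1 - star d * a)) = 1 := by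
    rw [mul_assoc, ← mul_assoc Q, hQR, one_mul, hVl]
  refine ⟨R * (1 - star d * a), V * Q, hWZ, hZW, ?_, rfl, ?_⟩
  · have hQnorm : ‖Q‖ ≤ 1 := by
      let _ := CStarAlgebra.spectralOrder B
      have _ := CStarAlgebra.spectralOrderedRing B
      have h1 : ‖star Q * Q‖ ≤ 1 := by
        rw [CStarAlgebra.norm_le_one_iff_of_nonneg _ (star_mul_self_nonneg Q), hQ.star_eq, hQQ]
        exact sub_le_self _ (star_mul_self_nonneg d)
      rw [CStarRing.norm_star_mul_self] at h1
      nlinarith [norm_nonneg Q]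
    have hone : ‖(1 : B)‖ ≤ 1 := by
      rcases subsingleton_or_nontrivial B with _ | _
      · simp [Subsingleton.elim (1 : B) 0]
      · exact CStarRing.norm_one.le
    have hV : V = 1 + star d * a * V := by
      have := hVr
      rw [sub_mul, one_mul, sub_eq_iff_eq_add] at this
      exact this
    have hVnorm : ‖V‖ ≤ 1 + ‖d‖ * ‖V‖ := by
      calc ‖V‖ = ‖1 + star d * a * V‖ := by rw [← hV]
        _ ≤ ‖(1 : B)‖ + ‖star d * a * V‖ := norm_add_le _ _
        _ ≤ 1 + ‖d‖ * ‖V‖ := by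
          refine add_le_add hone ((norm_mul_le _ _).trans ?_)
          refine mul_le_mul_of_nonneg_right ((norm_mul_le _ _).trans ?_) (norm_nonneg _)
          rw [norm_star]
          exact mul_le_of_le_one_right (norm_nonneg _) ha
    have hVQ : ‖V * Q‖ ≤ ‖V‖ :=
      (norm_mul_le _ _).trans (mul_le_of_le_one_right (norm_nonneg _) hQnorm)
    nlinarith [mul_le_mul_of_nonneg_right hVQ (sub_nonneg.2 hd.le)]
  · have h1 : star (V * Q) * (star (R * (1 - star d * a)) * (R * (1 - star d * a))) * (V * Q)
        = 1 := by
      calc _ = star ((R * (1 - star d * a)) * (V * Q)) * ((R * (1 - star d * a)) * (V * Q)) := by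
            simp only [star_mul, mul_assoc]
        _ = 1 := by rw [hWZ, star_one, one_mul]
    have h2 : star (P * (d - a) * V * Q) * (P * (d - a) * V * Q)
        = star (V * Q) * ((star d - star a) * (P * P) * (d - a)) * (V * Q) := by
      simp only [star_mul, star_sub, hP.star_eq, mul_assoc]
    have h3 : star (R * (1 - star d * a)) * (R * (1 - star d * a))
        = (1 - star a * d) * (R * R) * (1 - star d * a) := by
      simp only [star_mul, star_sub, star_one, star_star, hR.star_eq, mul_assoc]
    rw [← hid, h2, mul_sub (star (V * Q)), sub_mul _ _ (V * Q), ← h3, h1]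

lemma norm_pseudoHypDiff_le_one {d a : B} (hd : ‖d‖ < 1) (ha : ‖a‖ ≤ 1) :
    ‖pseudoHypDiff d a‖ ≤ 1 := by
  let _ := CStarAlgebra.spectralOrder B
  have _ := CStarAlgebra.spectralOrderedRing B
  obtain ⟨W, Z, -, -, -, -, h⟩ := exists_one_sub_star_mul_pseudoHypDiff hd ha
  have h1 : star a * a ≤ 1 := by
    rw [← CStarAlgebra.norm_le_one_iff_of_nonneg _ (star_mul_self_nonneg a),
      CStarRing.norm_star_mul_self]
    exact mul_le_one₀ ha (norm_nonneg _) ha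
  have h2 := star_left_conjugate_nonneg (sub_nonneg.2 h1) Z
  rw [← h, sub_nonneg, ← CStarAlgebra.norm_le_one_iff_of_nonneg _ (star_mul_self_nonneg _),
    CStarRing.norm_star_mul_self] at h2
  nlinarith [norm_nonneg (pseudoHypDiff d a)]

lemma norm_pseudoHypDiff_zero {d : B} (hd : ‖d‖ < 1) : ‖pseudoHypDiff d 0‖ = ‖d‖ := by
  obtain ⟨W, Z, -, -, -, hZ, h⟩ :=
    exists_one_sub_star_mul_pseudoHypDiff (a := 0) hd (by simp)
  have hT : star (pseudoHypDiff d 0) * pseudoHypDiff d 0 = star d * d := by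
    rw [← sub_right_inj (a := (1 : B)), h, hZ]
    simp [(isSelfAdjoint_cfcSqrt (1 - star d * d)).star_eq,
      cfcSqrt_mul_self (isSelfAdjoint_one_sub_star_mul d) (spectrum_one_sub_star_mul_pos hd)]
  have := congrArg norm hT
  rwa [CStarRing.norm_star_mul_self, CStarRing.norm_star_mul_self,
    mul_self_inj (norm_nonneg _) (norm_nonneg _)] at this

/-- If the pseudo-hyperbolic distance from `d` to `a` is at most `c`, then `‖a‖` is bounded away
from `1` in terms of `c` and `‖d‖`. -/
lemma norm_sq_le_of_norm_pseudoHypDiff_le {d a : B} {c : ℝ} (hd : ‖d‖ < 1) (ha : ‖a‖ ≤ 1)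
    (hc : c < 1) (h : ‖pseudoHypDiff d a‖ ≤ c) :
    ‖a‖ ^ 2 ≤ 1 - (1 - c ^ 2) * (1 - ‖d‖) ^ 2 := by
  let _ := CStarAlgebra.spectralOrder B
  have _ := CStarAlgebra.spectralOrderedRing B
  obtain ⟨W, Z, hWZ, hZW, hZ, -, hid⟩ := exists_one_sub_star_mul_pseudoHypDiff hd ha
  have hc0 : 0 ≤ c := (norm_nonneg _).trans h
  have hd0 := norm_nonneg d
  have hc1 : 0 ≤ 1 - c ^ 2 := by nlinarith
  have h1 : algebraMap ℝ B (1 - c ^ 2) ≤ star Z * (1 - star a * a) * Z := by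
    rw [← hid, map_sub, map_one]
    refine sub_le_sub_left (CStarAlgebra.star_mul_le_algebraMap_norm_sq.trans ?_) _
    exact algebraMap_mono B (pow_le_pow_left₀ (norm_nonneg _) h 2)
  have h2 : (1 - c ^ 2) • (star W * W) ≤ 1 - star a * a := by
    have := star_left_conjugate_le_conjugate h1 W
    rw [show star W * (star Z * (1 - star a * a) * Z) * W
        = star (Z * W) * (1 - star a * a) * (Z * W) by simp only [star_mul, mul_assoc], hZW,
      star_one, one_mul, mul_one] at this
    simpa [Algebra.algebraMap_eq_smul_one] using this
  have h3 : (1 : B) ≤ (‖Z‖ ^ 2) • (star W * W) := by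
    have := star_left_conjugate_le_conjugate
      (CStarAlgebra.star_mul_le_algebraMap_norm_sq (a := Z)) W
    rw [show star W * (star Z * Z) * W = star (Z * W) * (Z * W) by
      simp only [star_mul, mul_assoc], hZW, star_one, one_mul] at this
    simpa [Algebra.algebraMap_eq_smul_one] using this
  have h4 : ((1 - ‖d‖) ^ 2) • (1 : B) ≤ star W * W := by
    calc ((1 - ‖d‖) ^ 2) • (1 : B) ≤ ((1 - ‖d‖) ^ 2) • (‖Z‖ ^ 2) • (star W * W) :=
          smul_le_smul_of_nonneg_left h3 (sq_nonneg _)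
      _ = ((‖Z‖ * (1 - ‖d‖)) ^ 2) • (star W * W) := by rw [smul_smul]; congr 1; ring
      _ ≤ (1 : ℝ) • (star W * W) := by
          refine smul_le_smul_of_nonneg_right ?_ (star_mul_self_nonneg W)
          exact pow_le_one₀ (mul_nonneg (norm_nonneg _) (sub_nonneg.2 hd.le)) hZ
      _ = star W * W := one_smul _ _
  have h5 : star a * a ≤ algebraMap ℝ B (1 - (1 - c ^ 2) * (1 - ‖d‖) ^ 2) := by
    have := (smul_le_smul_of_nonneg_left h4 hc1).trans h2
    rw [map_sub, map_one, Algebra.algebraMap_eq_smul_one, mul_smul]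
    exact le_sub_comm.1 this
  rw [← CStarAlgebra.norm_le_iff_le_algebraMap _ _ (star_mul_self_nonneg a),
    CStarRing.norm_star_mul_self] at h5
  · rwa [sq]
  · have h6 : (1 - ‖d‖) ^ 2 ≤ 1 := pow_le_one₀ (sub_nonneg.2 hd.le) (by linarith)
    have h7 : 1 - c ^ 2 ≤ 1 := by nlinarith
    linarith [mul_le_one₀ h7 (sq_nonneg (1 - ‖d‖)) h6]

lemma pseudoHypDiff_algebraMap {s : ℝ} (hs0 : 0 ≤ s) (hs : s < 1) (y : B) :
    pseudoHypDiff (algebraMap ℝ B s) y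
      = (algebraMap ℝ B s - y) * Ring.inverse (1 - algebraMap ℝ B s * y) := by
  have hstar : star (algebraMap ℝ B s) = algebraMap ℝ B s := by
    rw [← algebraMap_star_comm, star_trivial]
  have h1 : (1 : B) - algebraMap ℝ B s * algebraMap ℝ B s = algebraMap ℝ B (1 - s * s) := by
    simp
  have hpos : Real.sqrt (1 - s * s) ≠ 0 := (Real.sqrt_pos.2 (by nlinarith)).ne'
  rw [pseudoHypDiff, hstar, h1, cfcInvSqrt, cfcSqrt, cfc_algebraMap, cfc_algebraMap,
    ← Algebra.commutes, ← mul_assoc, ← mul_assoc, ← map_mul, mul_inv_cancel₀ hpos, map_one, one_mul]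

/-- Moving `0` and `p` by a real Möbius map of parameter `s` increases the distance. -/
lemma le_norm_pseudoHypDiff_sub {s : ℝ} (hs0 : 0 ≤ s) (hs : s < 1) {p : B}
    (hp : ‖star p * p‖ ≤ 1) :
    (1 - s ^ 2) * ‖star p * p‖ ≤ (1 - s * ‖star p * p‖) *
      ‖pseudoHypDiff (algebraMap ℝ B s) (star p * p) - pseudoHypDiff (algebraMap ℝ B s) 0‖ := by
  rcases subsingleton_or_nontrivial B with _ | _
  · simp [Subsingleton.elim _ (0 : B)]
  let _ := CStarAlgebra.spectralOrder B
  have _ := CStarAlgebra.spectralOrderedRing B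
  rw [pseudoHypDiff_algebraMap hs0 hs, pseudoHypDiff_algebraMap hs0 hs]
  have hq0 := star_mul_self_nonneg p
  generalize star p * p = q at hp hq0 ⊢
  have hqsa : IsSelfAdjoint q := .of_nonneg hq0
  have hden : ∀ u ∈ spectrum ℝ q, 1 - s * u ≠ 0 := by
    intro u hu
    have h1 : u ≤ 1 := (Real.le_norm_self u).trans ((spectrum.norm_le_norm_of_mem hu).trans hp)
    have h2 := spectrum_nonneg_of_nonneg hq0 hu
    nlinarith
  have hcont : ContinuousOn (fun u : ℝ => (1 - s ^ 2) * u / (1 - s * u)) (spectrum ℝ q) := by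
    refine ContinuousOn.div (by fun_prop) (by fun_prop) hden
  have hlin : cfc (fun u : ℝ => 1 - s * u) q = 1 - algebraMap ℝ B s * q := by
    rw [cfc_sub _ _ q, cfc_const_one ℝ q, cfc_const_mul_id s q, Algebra.smul_def]
  have hmul : cfc (fun u : ℝ => (1 - s ^ 2) * u / (1 - s * u)) q * (1 - algebraMap ℝ B s * q)
      = algebraMap ℝ B (1 - s ^ 2) * q := by
    rw [← hlin, ← cfc_mul _ _ q hcont, ← Algebra.smul_def, ← cfc_const_mul_id (1 - s ^ 2) q]
    exact cfc_congr fun u hu => div_mul_cancel₀ _ (hden u hu)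
  have hunit : IsUnit (1 - algebraMap ℝ B s * q) := by
    refine isUnit_one_sub_of_norm_lt_one ((norm_mul_le _ _).trans_lt ?_)
    rw [norm_algebraMap', Real.norm_of_nonneg hs0]
    exact (mul_le_of_le_one_right hs0 hp).trans_lt hs
  have hkey : (algebraMap ℝ B s - q) * Ring.inverse (1 - algebraMap ℝ B s * q)
      - (algebraMap ℝ B s - 0) * Ring.inverse (1 - algebraMap ℝ B s * 0)
      = -cfc (fun u : ℝ => (1 - s ^ 2) * u / (1 - s * u)) q := by
    rw [mul_zero, sub_zero, sub_zero, Ring.inverse_one, mul_one, sub_eq_iff_eq_add, eq_comm,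
      Ring.eq_mul_inverse_iff_mul_eq _ _ _ hunit, add_mul, neg_mul, hmul]
    simp only [map_sub, map_one, map_pow]
    noncomm_ring
  rw [hkey, norm_neg]
  have h := norm_apply_le_norm_cfc (fun u : ℝ => (1 - s ^ 2) * u / (1 - s * u)) q
    (CStarAlgebra.norm_mem_spectrum_of_nonneg hq0) hcont
  have hpos : 0 < 1 - s * ‖q‖ := by nlinarith [norm_nonneg q]
  have h' := (Real.le_norm_self _).trans h
  rw [div_le_iff₀ hpos] at h'
  linarith

end Moebius

section Artanh

lemma artanh_le_artanh {s t : ℝ} (hs : 0 ≤ s) (hst : s ≤ t) (ht : t < 1) :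
    artanh s ≤ artanh t := by
  unfold artanh
  have h1 : 0 < 1 - t := by linarith
  have h2 : 0 < 1 - s := by linarith
  have h3 : 0 ≤ 1 + t := by linarith
  gcongr

lemma exists_lt_one_forall_artanh_le (M : ℝ) :
    ∃ c < 1, 0 ≤ c ∧ ∀ t, 0 ≤ t → t < 1 → artanh t ≤ M → t ≤ c := by
  have hE := Real.exp_pos (2 * M)
  refine ⟨Real.exp (2 * M) / (Real.exp (2 * M) + 1), ?_, by positivity, fun t ht0 ht1 h => ?_⟩
  · rw [div_lt_one (by positivity)]; linarith
  · have h1 : 0 < 1 - t := by linarith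
    have h2 : Real.log ((1 + t) / (1 - t)) ≤ 2 * M := by unfold artanh at h; linarith
    rw [Real.log_le_iff_le_exp (by positivity), div_le_iff₀ h1] at h2
    rw [le_div_iff₀ (by positivity)]
    nlinarith

end Artanh

section Characters

variable {B : Type*} [CStarAlgebra B]

/-- `Φ` is a contractive unital homomorphism from `A` to `D` which fixes `D` pointwise. -/
structure IsDCharacter (A D : Subalgebra ℂ B) (Φ : ↥A →ₐ[ℂ] B) : Prop where
  mem (a : ↥A) : Φ a ∈ D
  norm_le (a : ↥A) : ‖Φ a‖ ≤ ‖(a : B)‖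
  eq_self (a : ↥A) (ha : (a : B) ∈ D) : Φ a = a

lemma map_ringInverse {R S F : Type*} [Ring R] [Ring S] [FunLike F R S] [MonoidHomClass F R S]
    (f : F) {u : R} (hu : IsUnit u) : f (Ring.inverse u) = Ring.inverse (f u) := by
  obtain ⟨u, rfl⟩ := hu
  have := Ring.inverse_unit (Units.map (f : R →* S) u)
  rw [Ring.inverse_unit]
  simpa using this.symm

lemma cfc_mem_of_isClosed {D : Subalgebra ℂ B} (hDstar : ∀ d ∈ D, star d ∈ D)
    (hDclosed : IsClosed (D : Set B)) (f : ℝ → ℝ) {d : B} (hd : d ∈ D) : cfc f d ∈ D := by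
  let S : StarSubalgebra ℂ B := { D with star_mem' := fun {d} hd => hDstar d hd }
  have : IsClosed (S : Set B) := hDclosed
  exact cfc_mem (𝕜' := ℂ) (s := S) f hd

variable {A D : Subalgebra ℂ B}

/-- Möbius maps attached to elements of `D` preserve `A` and commute with `D`-characters. -/
lemma exists_coe_eq_pseudoHypDiff (hAclosed : IsClosed (A : Set B))
    (hDstar : ∀ d ∈ D, star d ∈ D) (hDclosed : IsClosed (D : Set B)) (hDA : D ≤ A)
    {d : B} (hdD : d ∈ D) (hd : ‖d‖ < 1) (a : ↥A) (ha : ‖(a : B)‖ ≤ 1) :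
    ∃ b : ↥A, ‖(b : B)‖ ≤ 1 ∧
      ∀ Φ : ↥A →ₐ[ℂ] B, IsDCharacter A D Φ → Φ b = pseudoHypDiff d (Φ a) := by
  have : CompleteSpace ↥A := hAclosed.completeSpace_coe
  have hsD := hDstar d hdD
  have hP : cfcInvSqrt (1 - d * star d) ∈ D :=
    cfc_mem_of_isClosed hDstar hDclosed _ (D.sub_mem D.one_mem (D.mul_mem hdD hsD))
  have hQ : cfcSqrt (1 - star d * d) ∈ D :=
    cfc_mem_of_isClosed hDstar hDclosed _ (D.sub_mem D.one_mem (D.mul_mem hsD hdD))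
  let d' : ↥A := ⟨d, hDA hdD⟩
  let s' : ↥A := ⟨star d, hDA hsD⟩
  let P' : ↥A := ⟨_, hDA hP⟩
  let Q' : ↥A := ⟨_, hDA hQ⟩
  have hunit : IsUnit (1 - s' * a) :=
    isUnit_one_sub_of_norm_lt_one (show ‖star d * (a : B)‖ < 1 from norm_star_mul_lt_one hd ha)
  refine ⟨P' * (d' - a) * Ring.inverse (1 - s' * a) * Q', ?_, fun Φ hΦ => ?_⟩
  · have h : A.val (P' * (d' - a) * Ring.inverse (1 - s' * a) * Q') = pseudoHypDiff d a := by
      rw [map_mul, map_mul, map_ringInverse _ hunit]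
      rfl
    rw [← Subalgebra.coe_val, h]
    exact norm_pseudoHypDiff_le_one hd ha
  · rw [map_mul, map_mul, map_ringInverse _ hunit, map_mul, map_sub, map_sub, map_one, map_mul,
      hΦ.eq_self P' hP, hΦ.eq_self Q' hQ, hΦ.eq_self s' hsD, hΦ.eq_self d' hdD]
    rfl

variable {Φ Ψ : ↥A →ₐ[ℂ] B}

lemma exists_norm_le_on_ker_of_norm_sub_le (hAclosed : IsClosed (A : Set B))
    (hDstar : ∀ d ∈ D, star d ∈ D) (hDclosed : IsClosed (D : Set B)) (hDA : D ≤ A)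
    (hΦ : IsDCharacter A D Φ) (hΨ : IsDCharacter A D Ψ) {k : ℝ} (hk : k < 2)
    (h : ∀ a : ↥A, ‖(a : B)‖ ≤ 1 → ‖Φ a - Ψ a‖ ≤ k) :
    ∃ c : ℝ, c < 1 ∧ ∀ x : ↥A, Ψ x = 0 → ‖Φ x‖ ≤ c * ‖(x : B)‖ := by
  have hk0 : 0 ≤ k := by simpa using h 0 (by simp)
  have hden : 0 < 1 + k ^ 2 / 4 := by positivity
  refine ⟨Real.sqrt (k / (1 + k ^ 2 / 4)), ?_, fun x hx => ?_⟩
  · rw [Real.sqrt_lt' one_pos, one_pow, div_lt_one hden]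
    nlinarith
  have hball : ∀ x : ↥A, Ψ x = 0 → ‖(x : B)‖ ≤ 1 → ‖Φ x‖ ≤ Real.sqrt (k / (1 + k ^ 2 / 4)) := by
    intro x hx hx1
    have hΦx : ‖Φ x‖ ≤ 1 := (hΦ.norm_le x).trans hx1
    have hxD := hDstar _ (hΦ.mem x)
    let s' : ↥A := ⟨star (Φ x), hDA hxD⟩
    have hs'x : ‖((s' * x : ↥A) : B)‖ ≤ 1 := by
      refine (norm_mul_le (star (Φ x)) (x : B)).trans ?_
      rw [norm_star]
      exact mul_le_one₀ hΦx (norm_nonneg _) hx1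
    have hsD : algebraMap ℝ B (k / 2) ∈ D := by
      rw [IsScalarTower.algebraMap_apply ℝ ℂ B]
      exact D.algebraMap_mem _
    have hsnorm : ‖algebraMap ℝ B (k / 2)‖ < 1 := by
      rcases subsingleton_or_nontrivial B with _ | _
      · simp [Subsingleton.elim _ (0 : B)]
      · rw [norm_algebraMap', Real.norm_of_nonneg (by positivity)]; linarith
    obtain ⟨b, hb, hbmap⟩ :=
      exists_coe_eq_pseudoHypDiff hAclosed hDstar hDclosed hDA hsD hsnorm (s' * x) hs'x
    have hbk := h b hb
    rw [hbmap Φ hΦ, hbmap Ψ hΨ, map_mul, map_mul, hx, mul_zero, hΦ.eq_self s' hxD] at hbk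
    have hp : ‖star (Φ x) * Φ x‖ ≤ 1 := by
      rw [CStarRing.norm_star_mul_self]
      exact mul_le_one₀ hΦx (norm_nonneg _) hΦx
    have hmain := le_norm_pseudoHypDiff_sub (s := k / 2) (by positivity) (by linarith) hp
    refine Real.le_sqrt_of_sq_le ?_
    rw [le_div_iff₀ hden, sq, ← CStarRing.norm_star_mul_self]
    have hnn : 0 ≤ 1 - k / 2 * ‖star (Φ x) * Φ x‖ := by
      nlinarith [norm_nonneg (star (Φ x) * Φ x)]
    have := hmain.trans (mul_le_mul_of_nonneg_left hbk hnn)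
    nlinarith
  rcases (norm_nonneg (x : B)).eq_or_lt with h0 | hpos
  · have := hΦ.norm_le x
    rw [← h0] at this ⊢
    linarith
  · have := hball (((‖(x : B)‖⁻¹ : ℝ) : ℂ) • x) (by simp [hx])
      (by simp [norm_smul, hpos.ne'])
    rw [map_smul, norm_smul, Complex.norm_real, norm_inv, norm_norm, inv_mul_le_iff₀ hpos] at this
    linarith

lemma exists_norm_sub_le_of_norm_le_on_ker (hDA : D ≤ A)
    (hΦ : IsDCharacter A D Φ) (hΨ : IsDCharacter A D Ψ)
    (h : ∃ c : ℝ, c < 1 ∧ ∀ x : ↥A, Ψ x = 0 → ‖Φ x‖ ≤ c * ‖(x : B)‖) :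
    ∃ k : ℝ, k < 2 ∧ ∀ a : ↥A, ‖(a : B)‖ ≤ 1 → ‖Φ a - Ψ a‖ ≤ k := by
  obtain ⟨c, hc, h⟩ := h
  refine ⟨2 * max c 0, by linarith [max_lt hc one_pos], fun a ha => ?_⟩
  let y : ↥A := ⟨Ψ a, hDA (hΨ.mem a)⟩
  have h1 := h (a - y) (by rw [map_sub, hΨ.eq_self y (hΨ.mem a)]; exact sub_self _)
  rw [map_sub, hΦ.eq_self y (hΨ.mem a)] at h1
  have h2 : ‖((a - y : ↥A) : B)‖ ≤ 2 :=
    (norm_sub_le (a : B) (Ψ a)).trans (by linarith [hΨ.norm_le a])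
  calc ‖Φ a - Ψ a‖ ≤ c * ‖((a - y : ↥A) : B)‖ := h1
    _ ≤ max c 0 * 2 := mul_le_mul (le_max_left _ _) h2 (norm_nonneg _) (le_max_right _ _)
    _ = 2 * max c 0 := mul_comm _ _

lemma exists_hypDist_le_of_norm_le_on_ker (hAclosed : IsClosed (A : Set B))
    (hDstar : ∀ d ∈ D, star d ∈ D) (hDclosed : IsClosed (D : Set B)) (hDA : D ≤ A)
    (hΦ : IsDCharacter A D Φ) (hΨ : IsDCharacter A D Ψ)
    (h : ∃ c : ℝ, c < 1 ∧ ∀ x : ↥A, Φ x = 0 → ‖Ψ x‖ ≤ c * ‖(x : B)‖) :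
    ∃ M₀ : ℝ, 0 < M₀ ∧ ∀ a : ↥A, ‖(a : B)‖ < 1 → hypDist (Φ a) (Ψ a) ≤ M₀ := by
  obtain ⟨c, hc, h⟩ := h
  refine ⟨max (artanh (max c 0)) 1, by positivity, fun a ha => ?_⟩
  have hΦa : ‖Φ a‖ < 1 := (hΦ.norm_le a).trans_lt ha
  obtain ⟨b, hb, hbmap⟩ :=
    exists_coe_eq_pseudoHypDiff hAclosed hDstar hDclosed hDA (hΦ.mem a) hΦa a ha.le
  have h1 := h b (by rw [hbmap Φ hΦ]; simp [pseudoHypDiff])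
  rw [hbmap Ψ hΨ] at h1
  rw [hypDist_eq_artanh]
  refine (artanh_le_artanh (norm_nonneg _) (h1.trans ?_) (max_lt hc one_pos)).trans
    (le_max_left _ _)
  calc c * ‖(b : B)‖ ≤ max c 0 * 1 :=
        mul_le_mul (le_max_left _ _) hb (norm_nonneg _) (le_max_right _ _)
    _ = max c 0 := mul_one _

lemma exists_norm_le_on_ker_of_hypDist_le (hΦ : IsDCharacter A D Φ)
    (h : ∃ M₀ : ℝ, 0 < M₀ ∧ ∀ a : ↥A, ‖(a : B)‖ < 1 → hypDist (Φ a) (Ψ a) ≤ M₀) :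
    ∃ c : ℝ, c < 1 ∧ ∀ x : ↥A, Ψ x = 0 → ‖Φ x‖ ≤ c * ‖(x : B)‖ := by
  obtain ⟨M, -, h⟩ := h
  obtain ⟨c, hc, hc0, hcM⟩ := exists_lt_one_forall_artanh_le M
  refine ⟨c, hc, fun x hx => ?_⟩
  have key : ∀ r > ‖(x : B)‖, ‖Φ x‖ ≤ c * r := by
    intro r hr
    have hr0 : 0 < r := (norm_nonneg _).trans_lt hr
    let y : ↥A := ((r⁻¹ : ℝ) : ℂ) • x
    have hy : ‖(y : B)‖ < 1 := by
      simp only [y, Subalgebra.coe_smul, norm_smul, Complex.norm_real, norm_inv,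
        Real.norm_of_nonneg hr0.le]
      rwa [inv_mul_lt_iff₀ hr0, mul_one]
    have hΦy := (hΦ.norm_le y).trans_lt hy
    have h1 := h y hy
    rw [hypDist_eq_artanh, show Ψ y = 0 by rw [map_smul, hx, smul_zero], norm_pseudoHypDiff_zero hΦy] at h1
    have h2 := hcM _ (norm_nonneg _) hΦy h1
    simp only [y, map_smul, norm_smul, Complex.norm_real, norm_inv,
      Real.norm_of_nonneg hr0.le] at h2
    rw [inv_mul_le_iff₀ hr0] at h2
    linarith
  refine le_of_forall_pos_le_add fun ε hε => ?_
  have := key (‖(x : B)‖ + ε) (by linarith)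
  nlinarith

lemma tendsto_norm_of_norm_le_on_ker (hAclosed : IsClosed (A : Set B))
    (hDstar : ∀ d ∈ D, star d ∈ D) (hDclosed : IsClosed (D : Set B)) (hDA : D ≤ A)
    (hΦ : IsDCharacter A D Φ) (hΨ : IsDCharacter A D Ψ)
    (h : ∃ c : ℝ, c < 1 ∧ ∀ x : ↥A, Ψ x = 0 → ‖Φ x‖ ≤ c * ‖(x : B)‖)
    {a : ℕ → ↥A} (ha : ∀ n, ‖(a n : B)‖ ≤ 1)
    (hlim : Tendsto (fun n => ‖Φ (a n)‖) atTop (nhds 1)) :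
    Tendsto (fun n => ‖Ψ (a n)‖) atTop (nhds 1) := by
  obtain ⟨c, hc, h⟩ := h
  have hm : max c 0 < 1 := max_lt hc one_pos
  have hm0 : 0 ≤ max c 0 := le_max_right _ _
  have hδ : 0 < 1 - (max c 0) ^ 2 := by nlinarith
  have hΨ1 : ∀ n, ‖Ψ (a n)‖ ≤ 1 := fun n => (hΨ.norm_le _).trans (ha n)
  have key : ∀ n, ‖Φ (a n)‖ ^ 2 ≤ 1 - (1 - (max c 0) ^ 2) * (1 - ‖Ψ (a n)‖) ^ 2 := by
    intro n
    have hΦ1 : ‖Φ (a n)‖ ≤ 1 := (hΦ.norm_le _).trans (ha n)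
    rcases (hΨ1 n).lt_or_eq with hlt | heq
    · obtain ⟨b, hb, hbmap⟩ :=
        exists_coe_eq_pseudoHypDiff hAclosed hDstar hDclosed hDA (hΨ.mem (a n)) hlt (a n) (ha n)
      have h1 := h b (by rw [hbmap Ψ hΨ]; simp [pseudoHypDiff])
      rw [hbmap Φ hΦ] at h1
      refine norm_sq_le_of_norm_pseudoHypDiff_le hlt hΦ1 hm (h1.trans ?_)
      calc c * ‖(b : B)‖ ≤ max c 0 * 1 :=
            mul_le_mul (le_max_left _ _) hb (norm_nonneg _) (le_max_right _ _)
        _ = max c 0 := mul_one _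
    · rw [heq]
      nlinarith [norm_nonneg (Φ (a n))]
  have hbound : ∀ n,
      1 - Real.sqrt ((1 - ‖Φ (a n)‖ ^ 2) / (1 - (max c 0) ^ 2)) ≤ ‖Ψ (a n)‖ := by
    intro n
    have : 1 - ‖Ψ (a n)‖ ≤ Real.sqrt ((1 - ‖Φ (a n)‖ ^ 2) / (1 - (max c 0) ^ 2)) := by
      refine Real.le_sqrt_of_sq_le ?_
      rw [le_div_iff₀ hδ]
      linarith [key n]
    linarith
  have hlow : Tendsto (fun n => 1 - Real.sqrt ((1 - ‖Φ (a n)‖ ^ 2) / (1 - (max c 0) ^ 2)))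
      atTop (nhds 1) := by
    have := ((((hlim.pow 2).const_sub 1).div_const (1 - (max c 0) ^ 2)).sqrt).const_sub 1
    simpa using this
  exact tendsto_of_tendsto_of_tendsto_of_le_of_le hlow tendsto_const_nhds hbound hΨ1

lemma exists_norm_le_on_ker_of_tendsto_norm (hΦ : IsDCharacter A D Φ)
    (h : ∀ a : ℕ → ↥A, (∀ n, ‖(a n : B)‖ ≤ 1) →
      Tendsto (fun n => ‖Φ (a n)‖) atTop (nhds 1) →
      Tendsto (fun n => ‖Ψ (a n)‖) atTop (nhds 1)) :
    ∃ c : ℝ, c < 1 ∧ ∀ x : ↥A, Ψ x = 0 → ‖Φ x‖ ≤ c * ‖(x : B)‖ := by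
  by_contra! hcon
  have hlt : ∀ n : ℕ, 1 - 1 / ((n : ℝ) + 1) < 1 := fun n => by
    have : 0 < 1 / ((n : ℝ) + 1) := by positivity
    linarith
  choose x hx hxc using fun n : ℕ => hcon _ (hlt n)
  have hpos : ∀ n, 0 < ‖(x n : B)‖ := by
    intro n
    refine (norm_nonneg _).lt_of_ne fun h0 => ?_
    have h1 := hxc n
    have h2 := hΦ.norm_le (x n)
    rw [← h0] at h1 h2
    linarith
  have hnorm : ∀ n, ‖((((‖(x n : B)‖⁻¹ : ℝ) : ℂ) • x n : ↥A) : B)‖ ≤ 1 := fun n => by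
    simp [norm_smul, (hpos n).ne']
  have hlim := h (fun n => ((‖(x n : B)‖⁻¹ : ℝ) : ℂ) • x n) hnorm <| by
    refine tendsto_of_tendsto_of_tendsto_of_le_of_le
      (g := fun n : ℕ => 1 - 1 / ((n : ℝ) + 1)) (h := fun _ => 1) ?_ tendsto_const_nhds
      (fun n => ?_) (fun n => (hΦ.norm_le _).trans (hnorm n))
    · simpa using (tendsto_one_div_add_atTop_nhds_zero_nat (𝕜 := ℝ)).const_sub 1
    · simp only [map_smul, norm_smul, Complex.norm_real, norm_inv, norm_norm]
      rw [le_inv_mul_iff₀ (hpos n)]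
      linarith [hxc n]
  simp only [map_smul, hx, smul_zero, norm_zero] at hlim
  exact zero_ne_one (tendsto_nhds_unique tendsto_const_nhds hlim)

end Characters

/-- **Gleason equivalence for `D`-characters.** Let `B` be a unital C*-algebra,
`A` a norm-closed unital subalgebra of `B`, `D` a C*-subalgebra of `A` containing the unit, and
`Φ, Ψ : A → D` be `D`-characters. Then the following are equivalent:
(1) `‖Φ − Ψ‖ < 2`; (2) `‖Φ|_{ker Ψ}‖ < 1`; (3) the hyperbolic distances `ρ(Φ(a), Ψ(a))` for
`‖a‖ < 1` are bounded; (4) `‖Φ(aₙ)‖ → 1` implies `‖Ψ(aₙ)‖ → 1` for sequences in the closed unit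
ball of `A`. -/
theorem gleason_part_equivalences
    {B : Type*} [CStarAlgebra B]
    (A D : Subalgebra ℂ B)
    (hAclosed : IsClosed (A : Set B))
    (hDstar : ∀ d ∈ D, star d ∈ D)
    (hDclosed : IsClosed (D : Set B))
    (hDA : D ≤ A)
    (Φ Ψ : ↥A →ₐ[ℂ] B)
    (hΦD : ∀ a : ↥A, Φ a ∈ D) (hΨD : ∀ a : ↥A, Ψ a ∈ D)
    (hΦcontr : ∀ a : ↥A, ‖Φ a‖ ≤ ‖(a : B)‖) (hΨcontr : ∀ a : ↥A, ‖Ψ a‖ ≤ ‖(a : B)‖)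
    (hΦid : ∀ d : B, ∀ hd : d ∈ D, Φ ⟨d, hDA hd⟩ = d)
    (hΨid : ∀ d : B, ∀ hd : d ∈ D, Ψ ⟨d, hDA hd⟩ = d) :
    ((∃ k : ℝ, k < 2 ∧ ∀ a : ↥A, ‖(a : B)‖ ≤ 1 → ‖Φ a - Ψ a‖ ≤ k) ↔
        (∃ c : ℝ, c < 1 ∧ ∀ x : ↥A, Ψ x = 0 → ‖Φ x‖ ≤ c * ‖(x : B)‖)) ∧
      ((∃ c : ℝ, c < 1 ∧ ∀ x : ↥A, Ψ x = 0 → ‖Φ x‖ ≤ c * ‖(x : B)‖) ↔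
        (∃ M₀ : ℝ, 0 < M₀ ∧ ∀ a : ↥A, ‖(a : B)‖ < 1 → hypDist (Φ a) (Ψ a) ≤ M₀)) ∧
      ((∃ M₀ : ℝ, 0 < M₀ ∧ ∀ a : ↥A, ‖(a : B)‖ < 1 → hypDist (Φ a) (Ψ a) ≤ M₀) ↔
        (∀ a : ℕ → ↥A, (∀ n, ‖(a n : B)‖ ≤ 1) →
          Tendsto (fun n => ‖Φ (a n)‖) atTop (nhds 1) →
          Tendsto (fun n => ‖Ψ (a n)‖) atTop (nhds 1))) := by
  have hΦ : IsDCharacter A D Φ := ⟨hΦD, hΦcontr, fun a ha => hΦid a ha⟩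
  have hΨ : IsDCharacter A D Ψ := ⟨hΨD, hΨcontr, fun a ha => hΨid a ha⟩
  have h12 : (∃ k : ℝ, k < 2 ∧ ∀ a : ↥A, ‖(a : B)‖ ≤ 1 → ‖Φ a - Ψ a‖ ≤ k) →
      ∃ c : ℝ, c < 1 ∧ ∀ x : ↥A, Ψ x = 0 → ‖Φ x‖ ≤ c * ‖(x : B)‖ := fun ⟨_, hk, h⟩ =>
    exists_norm_le_on_ker_of_norm_sub_le hAclosed hDstar hDclosed hDA hΦ hΨ hk h
  have h23 : (∃ c : ℝ, c < 1 ∧ ∀ x : ↥A, Ψ x = 0 → ‖Φ x‖ ≤ c * ‖(x : B)‖) →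
      ∃ M₀ : ℝ, 0 < M₀ ∧ ∀ a : ↥A, ‖(a : B)‖ < 1 → hypDist (Φ a) (Ψ a) ≤ M₀ := fun h => by
    obtain ⟨k, hk, hk'⟩ := exists_norm_sub_le_of_norm_le_on_ker hDA hΦ hΨ h
    exact exists_hypDist_le_of_norm_le_on_ker hAclosed hDstar hDclosed hDA hΦ hΨ <|
      exists_norm_le_on_ker_of_norm_sub_le hAclosed hDstar hDclosed hDA hΨ hΦ hk
        fun a ha => norm_sub_rev (Φ a) (Ψ a) ▸ hk' a ha
  have h32 := exists_norm_le_on_ker_of_hypDist_le (Ψ := Ψ) hΦ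
  exact ⟨⟨h12, exists_norm_sub_le_of_norm_le_on_ker hDA hΦ hΨ⟩, ⟨h23, h32⟩,
    fun h _ => tendsto_norm_of_norm_le_on_ker hAclosed hDstar hDclosed hDA hΦ hΨ (h32 h),
    fun h => h23 (exists_norm_le_on_ker_of_tendsto_norm hΦ h)⟩
end
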